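/- Let u₁ ∈ ℝ and set X = f − u₁·g. For every n ≥ 0 and every x = (x₁, x₂) ∈ ℝ² with x₁ > 0: ad^{2n+1}X(g)(x) = (4u₁)ⁿ·[f, g](x) and ad^{2n+2}X(g)(x) = 2·(4u₁)ⁿ·(f(x) + u₁·g(x)). (Iterated adjoint identities for the X field, used in Lemma 3.6.) -/

import Mathlib

/-- The drift vector field `f(x₁,x₂) = (x₂, x₁⁻³)`, extended by `0⁻¹ = 0`. -/
noncomputable def fVF : ℝ × ℝ → ℝ × ℝ := fun x => (x.2, ((x.1)^3)⁻¹)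

/-- The control vector field `g(x₁,x₂) = (0, −x₁)`. -/
def gVF : ℝ × ℝ → ℝ × ℝ := fun x => (0, -x.1)

/-- Lie bracket of vector fields on ℝ²: `[V,W](x) = DW(x)·V(x) − DV(x)·W(x)`. -/
noncomputable def lieBr (V W : ℝ × ℝ → ℝ × ℝ) : ℝ × ℝ → ℝ × ℝ :=
  fun x => fderiv ℝ W x (V x) - fderiv ℝ V x (W x)

/-- Adjoint iterates: `ad⁰V(W) = W`, `ad^{k+1}V(W) = [V, ad^k V(W)]`. -/
noncomputable def adIter (V : ℝ × ℝ → ℝ × ℝ) : ℕ → (ℝ × ℝ → ℝ × ℝ) → (ℝ × ℝ → ℝ × ℝ)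
  | 0, W => W
  | (k+1), W => lieBr V (adIter V k W)

/-- The bracket at a point only depends on the germ and the derivative of the second field. -/
lemma lieBr_eq_of_eventuallyEq {V W W₀ : ℝ × ℝ → ℝ × ℝ} {V' W' : ℝ × ℝ →L[ℝ] ℝ × ℝ} {x : ℝ × ℝ}
    (hV : HasFDerivAt V V' x) (hW : HasFDerivAt W₀ W' x) (h : W =ᶠ[nhds x] W₀) :
    lieBr V W x = W' (V x) - V' (W₀ x) := by
  rw [lieBr, h.fderiv_eq, hW.fderiv, hV.fderiv, h.eq_of_nhds]

lemma hasFDerivAt_gVF (x : ℝ × ℝ) :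
    HasFDerivAt gVF ((0 : ℝ × ℝ →L[ℝ] ℝ).prod (-ContinuousLinearMap.fst ℝ ℝ ℝ)) x :=
  (hasFDerivAt_const (0 : ℝ) x).prodMk hasFDerivAt_fst.fun_neg

lemma hasFDerivAt_fVF {x : ℝ × ℝ} (hx : 0 < x.1) :
    HasFDerivAt fVF ((ContinuousLinearMap.snd ℝ ℝ ℝ).prod
      ((-3 * (x.1 ^ 4)⁻¹) • ContinuousLinearMap.fst ℝ ℝ ℝ)) x := by
  have hd : HasDerivAt (fun t : ℝ => (t ^ 3)⁻¹) (-3 * (x.1 ^ 4)⁻¹) x.1 := by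
    have h := (hasDerivAt_pow 3 x.1).fun_inv (pow_ne_zero 3 hx.ne')
    refine h.congr_deriv ?_
    have := hx.ne'
    simp
    field_simp
  have hc := hd.comp_hasFDerivAt x (hasFDerivAt_fst (𝕜 := ℝ) (p := x))
  exact hasFDerivAt_snd.prodMk hc

lemma lieBr_fVF_gVF {x : ℝ × ℝ} (hx : 0 < x.1) : lieBr fVF gVF x = (x.1, -x.2) := by
  rw [lieBr_eq_of_eventuallyEq (hasFDerivAt_fVF hx) (hasFDerivAt_gVF x) .rfl]
  simp [fVF, gVF]

lemma lieBr_sub_smul_gVF (u : ℝ) {x : ℝ × ℝ} (hx : 0 < x.1) :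
    lieBr (fun y => fVF y - u • gVF y) gVF x = (x.1, -x.2) := by
  rw [lieBr_eq_of_eventuallyEq ((hasFDerivAt_fVF hx).fun_sub ((hasFDerivAt_gVF x).fun_const_smul u))
    (hasFDerivAt_gVF x) .rfl]
  simp [fVF, gVF]

lemma eventually_fst_pos {x : ℝ × ℝ} (hx : 0 < x.1) : ∀ᶠ y : ℝ × ℝ in nhds x, 0 < y.1 :=
  continuousAt_fst.eventually (lt_mem_nhds hx)

lemma lieBr_sub_smul_of_eq_hyperbolic (u c : ℝ) {W : ℝ × ℝ → ℝ × ℝ}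
    (hW : ∀ y : ℝ × ℝ, 0 < y.1 → W y = c • (y.1, -y.2)) {x : ℝ × ℝ} (hx : 0 < x.1) :
    lieBr (fun y => fVF y - u • gVF y) W x = (2 * c) • (fVF x + u • gVF x) := by
  have hd : HasFDerivAt (fun y : ℝ × ℝ => c • (y.1, -y.2)) (c • (ContinuousLinearMap.fst ℝ ℝ ℝ).prod
      (-ContinuousLinearMap.snd ℝ ℝ ℝ)) x :=
    HasFDerivAt.fun_const_smul (f := fun y : ℝ × ℝ => (y.1, -y.2))
      (hasFDerivAt_fst.prodMk hasFDerivAt_snd.fun_neg) c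
  rw [lieBr_eq_of_eventuallyEq ((hasFDerivAt_fVF hx).fun_sub ((hasFDerivAt_gVF x).fun_const_smul u))
    hd ((eventually_fst_pos hx).mono hW)]
  have := hx.ne'
  ext
  · simp [fVF, gVF]
    ring
  · simp [fVF, gVF]
    field_simp
    ring

lemma lieBr_sub_smul_of_eq_add_smul (u c : ℝ) {W : ℝ × ℝ → ℝ × ℝ}
    (hW : ∀ y : ℝ × ℝ, 0 < y.1 → W y = c • (fVF y + u • gVF y)) {x : ℝ × ℝ} (hx : 0 < x.1) :
    lieBr (fun y => fVF y - u • gVF y) W x = (2 * u * c) • (x.1, -x.2) := by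
  have hg := (hasFDerivAt_gVF x).fun_const_smul u
  rw [lieBr_eq_of_eventuallyEq ((hasFDerivAt_fVF hx).fun_sub hg)
    (((hasFDerivAt_fVF hx).fun_add hg).fun_const_smul c) ((eventually_fst_pos hx).mono hW)]
  ext
  · simp [fVF, gVF]
    ring
  · simp [fVF, gVF]
    ring

/-- Iterated adjoint identities for the field `X = f − u₁ g` (used in Lemma 3.6):
`ad^{2n+1}X(g) = (4u₁)ⁿ [f,g]` and `ad^{2n+2}X(g) = 2(4u₁)ⁿ (f + u₁ g)` on `{x₁ > 0}`. -/
theorem stmt_6 (u₁ : ℝ) :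
    ∀ n : ℕ, ∀ x : ℝ × ℝ, 0 < x.1 →
      adIter (fun y => fVF y - u₁ • gVF y) (2*n+1) gVF x
        = (4*u₁)^n • lieBr fVF gVF x ∧
      adIter (fun y => fVF y - u₁ • gVF y) (2*n+2) gVF x
        = (2 * (4*u₁)^n) • (fVF x + u₁ • gVF x) := by
  intro n
  have even_of_odd (n : ℕ) (hodd : ∀ x : ℝ × ℝ, 0 < x.1 →
      adIter (fun y => fVF y - u₁ • gVF y) (2*n+1) gVF x = (4*u₁)^n • (x.1, -x.2))
      (x : ℝ × ℝ) (hx : 0 < x.1) :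
      adIter (fun y => fVF y - u₁ • gVF y) (2*n+2) gVF x
        = (2 * (4*u₁)^n) • (fVF x + u₁ • gVF x) :=
    lieBr_sub_smul_of_eq_hyperbolic u₁ _ hodd hx
  have odd : ∀ x : ℝ × ℝ, 0 < x.1 →
      adIter (fun y => fVF y - u₁ • gVF y) (2*n+1) gVF x = (4*u₁)^n • (x.1, -x.2) := by
    induction n with
    | zero =>
      intro x hx
      rw [pow_zero, one_smul]
      exact lieBr_sub_smul_gVF u₁ hx
    | succ n ih =>
      intro x hx
      refine (lieBr_sub_smul_of_eq_add_smul u₁ _ (even_of_odd n ih) hx).trans ?_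
      congr 1
      ring
  intro x hx
  exact ⟨by rw [lieBr_fVF_gVF hx, odd x hx], even_of_odd n odd x hx⟩
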